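/- Let B = ℤ[a, u, r₀, r₁]/(2a), the polynomial ring in four variables over ℤ modulo the principal ideal generated by 2a. Let P = ℤ[δ, σ₀, σ₁, η₀, η₁] and let I ⊆ P be the ideal generated by the five elements 2η₀, 2η₁, δ² − σ₀σ₁, η₀σ₁ − η₁δ, and η₁σ₀ − η₀δ. Then the ring homomorphism φ : P → B determined by η₀ ↦ a·r₀, η₁ ↦ a·r₁, σ₀ ↦ u·r₀², σ₁ ↦ u·r₁², δ ↦ u·r₀·r₁ satisfies I ⊆ ker φ, and the induced ring homomorphism P/I → B is injective. In particular, the subring of B generated by a·r₀, a·r₁, u·r₀², u·r₁², u·r₀·r₁ is isomorphic to ℤ[δ, σ₀, σ₁, η₀, η₁]/I. -/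

import Mathlib

/-!
Statement 9: the subring of `B = ℤ[a,u,r₀,r₁]/(2a)` generated by
`a·r₀, a·r₁, u·r₀², u·r₁², u·r₀·r₁` is isomorphic to
`ℤ[δ,σ₀,σ₁,η₀,η₁]/(2η₀, 2η₁, δ² − σ₀σ₁, η₀σ₁ − η₁δ, η₁σ₀ − η₀δ)`,
via the homomorphism φ with η_ε ↦ a·r_ε, σ_ε ↦ u·r_ε², δ ↦ u·r₀·r₁:
the ideal `I` is contained in the kernel of `φ` and the induced map
`P/I → B` is injective.
-/

namespace Stmt9

open MvPolynomial

/-- `B = ℤ[a, u, r₀, r₁]/(2a)`, with the variables `X 0, X 1, X 2, X 3`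
standing for `a, u, r₀, r₁`. -/
noncomputable abbrev B :=
  MvPolynomial (Fin 4) ℤ ⧸
    Ideal.span ({2 * X 0} : Set (MvPolynomial (Fin 4) ℤ))

noncomputable def a : B := Ideal.Quotient.mk _ (X 0)
noncomputable def u : B := Ideal.Quotient.mk _ (X 1)
noncomputable def r0 : B := Ideal.Quotient.mk _ (X 2)
noncomputable def r1 : B := Ideal.Quotient.mk _ (X 3)

/-- `P = ℤ[δ, σ₀, σ₁, η₀, η₁]`, with the variables `X 0, ..., X 4`
standing for `δ, σ₀, σ₁, η₀, η₁`. -/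
noncomputable abbrev P := MvPolynomial (Fin 5) ℤ

/-- the ring homomorphism `φ : P → B` determined by `η₀ ↦ a·r₀`,
`η₁ ↦ a·r₁`, `σ₀ ↦ u·r₀²`, `σ₁ ↦ u·r₁²`, `δ ↦ u·r₀·r₁` -/
noncomputable def φ : P →+* B :=
  (aeval ![u * r0 * r1, u * r0 ^ 2, u * r1 ^ 2, a * r0, a * r1]).toRingHom

/-- the ideal `I ⊆ P` generated by `2η₀`, `2η₁`, `δ² − σ₀σ₁`,
`η₀σ₁ − η₁δ` and `η₁σ₀ − η₀δ` -/
noncomputable def I : Ideal P :=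
  Ideal.span {2 * X 3, 2 * X 4, X 0 ^ 2 - X 1 * X 2,
    X 3 * X 2 - X 4 * X 0, X 4 * X 1 - X 3 * X 0}

/-- normal form of a monomial -/
def nf {R : Type*} [CommRing R] (d s0 s1 h0 h1 : R) (A U W : ℕ) : R :=
  if W ≤ 2 * U then h0 ^ A * d ^ (W % 2) * s0 ^ (U - W / 2 - W % 2) * s1 ^ (W / 2)
  else h0 ^ (A - (W - 2 * U)) * h1 ^ (W - 2 * U) * s1 ^ U

theorem nf_two {R : Type*} [CommRing R] (d s0 s1 h0 h1 : R) (e0 : 2 * h0 = 0) (e1 : 2 * h1 = 0)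
    (A U W : ℕ) : 2 * nf d s0 s1 h0 h1 (A + 1) U W = 0 := by
  unfold nf
  split_ifs with h
  · rw [pow_succ]
    linear_combination (h0 ^ A * d ^ (W % 2) * s0 ^ (U - W / 2 - W % 2) * s1 ^ (W / 2)) * e0
  · obtain ⟨t, ht⟩ : ∃ t, W - 2 * U = t + 1 := ⟨W - 2 * U - 1, by omega⟩
    rw [ht, pow_succ h1]
    linear_combination (h0 ^ (A + 1 - (t + 1)) * h1 ^ t * s1 ^ U) * e1

theorem nf_eq {R : Type*} [CommRing R] (d s0 s1 h0 h1 : R) (e2 : d ^ 2 = s0 * s1)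
    (e3 : h0 * s1 = h1 * d) (e4 : h1 * s0 = h0 * d) (n : ℕ) :
    ∀ m k l i j : ℕ, 2 * j + m = n → d ^ m * s0 ^ k * s1 ^ l * h0 ^ i * h1 ^ j =
      nf d s0 s1 h0 h1 (i + j) (k + l + m) (j + 2 * l + m) := by
  induction n using Nat.strong_induction_on with
  | _ n ih =>
    intro m k l i j hn
    by_cases hm : 2 ≤ m
    · obtain ⟨m, rfl⟩ := Nat.exists_eq_add_of_le' hm
      have := ih (2 * j + m) (by omega) m (k + 1) (l + 1) i j rfl
      rw [show k + l + (m + 2) = k + 1 + (l + 1) + m by ring,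
        show j + 2 * l + (m + 2) = j + 2 * (l + 1) + m by ring, ← this]
      linear_combination (d ^ m * s0 ^ k * s1 ^ l * h0 ^ i * h1 ^ j) * e2
    · rcases j with _ | j
      · have hm' : m < 2 := by omega
        have a1 : (0 + 2 * l + m) % 2 = m := by omega
        have a2 : (0 + 2 * l + m) / 2 = l := by omega
        have a3 : k + l + m - l - m = k := by omega
        unfold nf
        rw [if_pos (by omega), a1, a2, a3]
        ring
      · rcases m with _ | m
        · rcases k with _ | k
          · unfold nf
            by_cases hj : j + 1 + 2 * l + 0 ≤ 2 * (0 + l + 0)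
            · omega
            · have a1 : j + 1 + 2 * l + 0 - 2 * (0 + l + 0) = j + 1 := by omega
              have a2 : i + (j + 1) - (j + 1) = i := by omega
              rw [if_neg hj, a1, a2]
              ring
          · have := ih (2 * j + 1) (by omega) 1 k l (i + 1) j rfl
            rw [show i + (j + 1) = i + 1 + j by ring, show k + 1 + l + 0 = k + l + 1 by ring,
              show j + 1 + 2 * l + 0 = j + 2 * l + 1 by ring, ← this]
            linear_combination (s0 ^ k * s1 ^ l * h0 ^ i * h1 ^ j) * e4
        · have := ih (2 * j + m) (by omega) m k (l + 1) (i + 1) j rfl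
          rw [show i + (j + 1) = i + 1 + j by ring,
            show k + l + (m + 1) = k + (l + 1) + m by ring,
            show j + 1 + 2 * l + (m + 1) = j + 2 * (l + 1) + m by ring, ← this]
          linear_combination (-(d ^ m * s0 ^ k * s1 ^ l * h0 ^ i * h1 ^ j)) * e3

/-- the class of a variable in the quotient -/
noncomputable def q (i : Fin 5) : P ⧸ I := Ideal.Quotient.mk I (X i)

theorem rel {x : P} (hx : x ∈ ({2 * X 3, 2 * X 4, X 0 ^ 2 - X 1 * X 2,
    X 3 * X 2 - X 4 * X 0, X 4 * X 1 - X 3 * X 0} : Set P)) : Ideal.Quotient.mk I x = 0 :=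
  Ideal.Quotient.eq_zero_iff_mem.2 (Ideal.subset_span hx)

theorem q0 : 2 * q 3 = 0 := by
  have h := rel (x := 2 * X 3) (by simp)
  rwa [map_mul, map_ofNat] at h
theorem q1 : 2 * q 4 = 0 := by
  have h := rel (x := 2 * X 4) (by simp)
  rwa [map_mul, map_ofNat] at h
theorem q2 : q 0 ^ 2 = q 1 * q 2 := by
  have h := rel (x := X 0 ^ 2 - X 1 * X 2) (by simp)
  rw [map_sub, sub_eq_zero] at h
  simpa only [q, map_mul, map_pow] using h
theorem q3 : q 3 * q 2 = q 4 * q 0 := by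
  have h := rel (x := X 3 * X 2 - X 4 * X 0) (by simp)
  rw [map_sub, sub_eq_zero] at h
  simpa only [q, map_mul, map_pow] using h
theorem q4 : q 4 * q 1 = q 3 * q 0 := by
  have h := rel (x := X 4 * X 1 - X 3 * X 0) (by simp)
  rw [map_sub, sub_eq_zero] at h
  simpa only [q, map_mul, map_pow] using h

/-- additive retraction -/
noncomputable def psi : MvPolynomial (Fin 4) ℤ →ₗ[ℤ] P ⧸ I :=
  (MvPolynomial.basisMonomials (Fin 4) ℤ).constr ℤ
    (fun e => nf (q 0) (q 1) (q 2) (q 3) (q 4) (e 0) (e 1) (e 3))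

theorem psi_monomial (e : Fin 4 →₀ ℕ) :
    psi (monomial e 1) = nf (q 0) (q 1) (q 2) (q 3) (q 4) (e 0) (e 1) (e 3) := by
  have := (MvPolynomial.basisMonomials (Fin 4) ℤ).constr_basis ℤ
    (fun e => nf (q 0) (q 1) (q 2) (q 3) (q 4) (e 0) (e 1) (e 3)) e
  rwa [coe_basisMonomials] at this

theorem psi_X (A U R S : ℕ) :
    psi (X 0 ^ A * X 1 ^ U * X 2 ^ R * X 3 ^ S) = nf (q 0) (q 1) (q 2) (q 3) (q 4) A U S := by
  have : (X 0 ^ A * X 1 ^ U * X 2 ^ R * X 3 ^ S : MvPolynomial (Fin 4) ℤ) =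
      monomial (Finsupp.equivFunOnFinite.symm ![A, U, R, S]) 1 := by
    rw [monomial_eq, Finsupp.prod_fintype _ _ (by simp), Fin.prod_univ_four]
    simp
  rw [this, psi_monomial]
  simp

theorem psi_van (p : MvPolynomial (Fin 4) ℤ) : psi (2 * X 0 * p) = 0 := by
  induction p using MvPolynomial.induction_on' with
  | add p q hp hq => rw [mul_add, map_add, hp, hq, add_zero]
  | monomial e c =>
    have : (2 * X 0 * monomial e c : MvPolynomial (Fin 4) ℤ) =
        (2 * c) • (X 0 ^ (e 0 + 1) * X 1 ^ (e 1) * X 2 ^ (e 2) * X 3 ^ (e 3)) := by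
      rw [monomial_eq, Finsupp.prod_fintype _ _ (by simp), Fin.prod_univ_four, smul_eq_C_mul]
      simp only [map_mul, map_ofNat]
      ring
    rw [this, map_smul, psi_X, mul_comm, mul_smul]
    have h2 := nf_two (q 0) (q 1) (q 2) (q 3) (q 4) q0 q1 (e 0) (e 1) (e 3)
    rw [two_smul, ← two_mul, h2, smul_zero]

/-- lift of `φ` -/
noncomputable def phi' : P →ₐ[ℤ] MvPolynomial (Fin 4) ℤ :=
  aeval ![X 1 * X 2 * X 3, X 1 * X 2 ^ 2, X 1 * X 3 ^ 2, X 0 * X 2, X 0 * X 3]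

theorem φ_eq (p : P) : φ p = Ideal.Quotient.mk _ (phi' p) := by
  have : φ = (Ideal.Quotient.mk _).comp (phi' : P →+* MvPolynomial (Fin 4) ℤ) := by
    apply MvPolynomial.ringHom_ext
    · intro n; simp
    · intro i
      fin_cases i <;> simp [φ, phi', a, u, r0, r1]
  rw [this]; rfl

theorem psi_phi (p : P) : psi (phi' p) = Ideal.Quotient.mk I p := by
  induction p using MvPolynomial.induction_on' with
  | add p q hp hq => rw [map_add, map_add, hp, hq, map_add]
  | monomial e c =>
    have h1 : (monomial e c : P) =
        c • (X 0 ^ e 0 * X 1 ^ e 1 * X 2 ^ e 2 * X 3 ^ e 3 * X 4 ^ e 4) := by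
      rw [monomial_eq, Finsupp.prod_fintype _ _ (by simp), Fin.prod_univ_five, smul_eq_C_mul]
    have h2 : phi' (X 0 ^ e 0 * X 1 ^ e 1 * X 2 ^ e 2 * X 3 ^ e 3 * X 4 ^ e 4) =
        X 0 ^ (e 3 + e 4) * X 1 ^ (e 1 + e 2 + e 0) * X 2 ^ (e 3 + 2 * e 1 + e 0) *
          X 3 ^ (e 4 + 2 * e 2 + e 0) := by
      simp [phi']
      ring
    rw [h1, map_smul, h2, map_smul, psi_X,
      ← nf_eq (q 0) (q 1) (q 2) (q 3) (q 4) q2 q3 q4 _ (e 0) (e 1) (e 2) (e 3) (e 4) rfl]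
    simp only [zsmul_eq_mul, map_mul, map_pow, map_intCast, q]

theorem φ_I : ∀ p ∈ I, φ p = 0 := by
  have h2 : 2 * a = 0 := by
    have : Ideal.Quotient.mk (Ideal.span ({2 * X 0} : Set (MvPolynomial (Fin 4) ℤ))) (2 * X 0) = 0 :=
      Ideal.Quotient.eq_zero_iff_mem.2 (Ideal.subset_span rfl)
    rwa [map_mul, map_ofNat] at this
  have : I ≤ RingHom.ker φ := by
    unfold I
    rw [Ideal.span_le]
    rintro x (rfl | rfl | rfl | rfl | rfl) <;>
      simp only [SetLike.mem_coe, RingHom.mem_ker] <;> simp [φ]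
    · linear_combination r0 * h2
    · linear_combination r1 * h2
    all_goals ring
  exact this

theorem φ_inj (p : P) (hp : φ p = 0) : p ∈ I := by
  rw [φ_eq, Ideal.Quotient.eq_zero_iff_mem, Ideal.mem_span_singleton] at hp
  obtain ⟨c, hc⟩ := hp
  rw [← Ideal.Quotient.eq_zero_iff_mem, ← psi_phi, hc, psi_van]

theorem φ_range : φ.range = Subring.closure
    ({a * r0, a * r1, u * r0 ^ 2, u * r1 ^ 2, u * r0 * r1} : Set B) := by
  apply le_antisymm
  · rintro _ ⟨p, rfl⟩
    induction p using MvPolynomial.induction_on with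
    | C n => 
      have : φ (C n) = (n : B) := by simp
      rw [this]; exact intCast_mem _ n
    | add p q hp hq => rw [map_add]; exact add_mem hp hq
    | mul_X p i hp =>
      rw [map_mul]
      refine mul_mem hp (Subring.subset_closure ?_)
      fin_cases i <;> simp [φ]
  · rw [Subring.closure_le]
    rintro x (rfl | rfl | rfl | rfl | rfl)
    · exact ⟨X 3, by simp [φ]⟩
    · exact ⟨X 4, by simp [φ]⟩
    · exact ⟨X 1, by simp [φ]⟩
    · exact ⟨X 2, by simp [φ]⟩
    · exact ⟨X 0, by simp [φ]⟩

/-- `I ⊆ ker φ`, the induced ring homomorphism `P/I → B` is injective,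
and in particular the subring of `B` generated by
`a·r₀, a·r₁, u·r₀², u·r₁², u·r₀·r₁` is isomorphic to `P/I`. -/
theorem statement9 :
    ∃ h : ∀ p ∈ I, φ p = 0,
      Function.Injective (Ideal.Quotient.lift I φ h) ∧
      Nonempty ((P ⧸ I) ≃+*
        Subring.closure
          ({a * r0, a * r1, u * r0 ^ 2, u * r1 ^ 2, u * r0 * r1} : Set B)) := by
  have hinj : Function.Injective (Ideal.Quotient.lift I φ φ_I) := by
    rw [injective_iff_map_eq_zero]
    intro x hx
    obtain ⟨p, rfl⟩ := Ideal.Quotient.mk_surjective x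
    rw [Ideal.Quotient.lift_mk] at hx
    exact Ideal.Quotient.eq_zero_iff_mem.2 (φ_inj p hx)
  refine ⟨φ_I, hinj, ?_⟩
  have hk : I = RingHom.ker φ := le_antisymm φ_I (fun p hp => φ_inj p hp)
  exact ⟨((Ideal.quotEquivOfEq hk).trans (RingHom.quotientKerEquivRange φ)).trans
    (RingEquiv.subringCongr φ_range)⟩

end Stmt9
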